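/- arXiv:2001.06470 — 2 statements merged into one kernel-verified Lean document; each statement's English description precedes it below -/
import Mathlib

section
/- Let A be a ULH superpattern of C_{i_1,…,i_n} ∈ 𝒞. Then A is a companion matrix if and only if the following three conditions hold: (i) the constant part of A is a nilpotent matrix; (ii) for each k = 1,…,n, the principal submatrix A[1,…,i_k−k] is a constant nilpotent matrix or the empty matrix; (iii) for each k = 1,…,n, the principal submatrix A[i_k+1,…,n] is a constant nilpotent matrix or the empty matrix. -/
open Polynomial Matrix

noncomputable section

/-- A square matrix is *unit lower Hessenberg* (ULH): every entry on the
superdiagonal equals `1` and every entry above the superdiagonal equals `0`. -/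
def IsULH {R : Type*} [Zero R] [One R] {m : ℕ} (A : Matrix (Fin m) (Fin m) R) : Prop :=
  (∀ i j : Fin m, (j : ℕ) = (i : ℕ) + 1 → A i j = 1) ∧
  (∀ i j : Fin m, (i : ℕ) + 1 < (j : ℕ) → A i j = 0)

/-- The total order `≺` on positions: `(i,j) ≺ (i',j')` iff `i−j < i'−j'`, or
`i−j = i'−j'` and `i < i'`. -/
def Prec {m : ℕ} (a b : Fin m × Fin m) : Prop :=
  ((a.1 : ℕ) - (a.2 : ℕ) < (b.1 : ℕ) - (b.2 : ℕ)) ∨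
  ((a.1 : ℕ) - (a.2 : ℕ) = (b.1 : ℕ) - (b.2 : ℕ) ∧ (a.1 : ℕ) < (b.1 : ℕ))

/-- `pos` is a valid family of variable positions for a matrix of `ℋ`:
each position is on or below the main diagonal, and the positions are
strictly increasing in the order `≺`. -/
def IsHPos {m : ℕ} (pos : Fin m → Fin m × Fin m) : Prop :=
  (∀ k, ((pos k).2 : ℕ) ≤ ((pos k).1 : ℕ)) ∧
  (∀ k l : Fin m, k < l → Prec (pos k) (pos l))

/-- `pos` is a valid family of variable positions for a matrix of `ℬ`:
in addition all variables lie in a common `t`-block, i.e.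
`max j_k ≤ min i_k`. -/
def IsBPos {m : ℕ} (pos : Fin m → Fin m × Fin m) : Prop :=
  IsHPos pos ∧ ∀ k l : Fin m, ((pos k).2 : ℕ) ≤ ((pos l).1 : ℕ)

/-- The ULH matrix `H_{(i₁,j₁),…,(iₙ,jₙ)}` with `2n−1` nonzero entries: ones on the
superdiagonal and the variable `xₖ` at position `pos k` (0-indexed). -/
def HMat (F : Type*) [Field F] {n : ℕ} (pos : Fin n → Fin n × Fin n) :
    Matrix (Fin n) (Fin n) (MvPolynomial (Fin n) F) :=
  fun i j => (if (j : ℕ) = (i : ℕ) + 1 then 1 else 0) +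
    ∑ k : Fin n, if pos k = (i, j) then MvPolynomial.X k else 0

/-- The positions of the variables of `C_{i₁,…,iₙ}`: in 1-based terms `xₖ` lies at
`(iₖ, iₖ−k+1)`; here 0-indexed, given the row function `r`, the variable `x_{k+1}`
lies at `(r k, r k − k)`. -/
def CPos {n : ℕ} (r : Fin n → Fin n) (k : Fin n) : Fin n × Fin n :=
  (r k, ⟨(r k : ℕ) - (k : ℕ), lt_of_le_of_lt (Nat.sub_le _ _) (r k).isLt⟩)

/-- The condition on the row indices defining the set `𝒞`: in 1-based terms
`k ≤ iₖ` and `iₖ−k+1 ≤ i₁ ≤ iₖ` for `k = 1,…,n`. -/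
def IsCIdx {n : ℕ} (hn : 0 < n) (r : Fin n → Fin n) : Prop :=
  ∀ k : Fin n, (k : ℕ) ≤ (r k : ℕ) ∧
    (r k : ℕ) - (k : ℕ) ≤ (r ⟨0, hn⟩ : ℕ) ∧ (r ⟨0, hn⟩ : ℕ) ≤ (r k : ℕ)

/-- The matrix `C_{i₁,…,iₙ}`. -/
def CMat (F : Type*) [Field F] {n : ℕ} (r : Fin n → Fin n) :
    Matrix (Fin n) (Fin n) (MvPolynomial (Fin n) F) :=
  HMat F (CPos r)

/-- The condition on the row indices defining the set `𝒢`: besides the `𝒞` conditions,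
the rows of the variables are exactly `i₁,…,n` and their columns exactly `1,…,i₁`. -/
def IsGIdx {n : ℕ} (hn : 0 < n) (r : Fin n → Fin n) : Prop :=
  IsCIdx hn r ∧
  (∀ i : Fin n, (∃ k, r k = i) ↔ (r ⟨0, hn⟩ : ℕ) ≤ (i : ℕ)) ∧
  (∀ j : Fin n, (∃ k, (r k : ℕ) - (k : ℕ) = (j : ℕ)) ↔ (j : ℕ) ≤ (r ⟨0, hn⟩ : ℕ))

/-- The condition on the row indices defining the set `ℱ` of Fiedler companion
matrices: besides the `𝒢` conditions, consecutive variables lie in the same row or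
the same column, i.e. `i_{k+1} = i_k` or `i_{k+1} = i_k + 1`. -/
def IsFIdx {n : ℕ} (hn : 0 < n) (r : Fin n → Fin n) : Prop :=
  IsGIdx hn r ∧
  ∀ k l : Fin n, (l : ℕ) = (k : ℕ) + 1 → (r l = r k ∨ (r l : ℕ) = (r k : ℕ) + 1)

/-- `B` is a *ULH superpattern* of `A`: `B` is obtained from `A` by replacing some
(possibly none) zero entries of `A` lying below the superdiagonal by nonzero
constants of `F`. -/
def IsULHSuperpatternOf {F : Type*} [Field F] {n : ℕ}
    (B A : Matrix (Fin n) (Fin n) (MvPolynomial (Fin n) F)) : Prop :=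
  (∀ i j : Fin n, (i : ℕ) < (j : ℕ) → B i j = A i j) ∧
  (∀ i j : Fin n, (j : ℕ) ≤ (i : ℕ) →
    B i j = A i j ∨ (A i j = 0 ∧ ∃ c : F, c ≠ 0 ∧ B i j = MvPolynomial.C c))

/-- `A` is a *companion matrix*: `n` of its entries are the variables `x₁,…,xₙ`,
the remaining entries are constants of `F`, and
`det(λI − A) = λⁿ − x₁λ^{n−1} − ⋯ − xₙ`. -/
def IsCompanion {F : Type*} [Field F] {n : ℕ}
    (A : Matrix (Fin n) (Fin n) (MvPolynomial (Fin n) F)) : Prop :=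
  (∃ pos : Fin n → Fin n × Fin n, Function.Injective pos ∧
    (∀ k : Fin n, A (pos k).1 (pos k).2 = MvPolynomial.X k) ∧
    (∀ i j : Fin n, (∀ k, pos k ≠ (i, j)) → ∃ c : F, A i j = MvPolynomial.C c)) ∧
  A.charpoly = Polynomial.X ^ n -
    ∑ k : Fin n, Polynomial.C (MvPolynomial.X k) * Polynomial.X ^ (n - 1 - (k : ℕ))

/-- `A` is a *PB-companion matrix* (companion with respect to a polynomial basis):
`n` of its entries are the variables `x₁,…,xₙ`, the remaining entries are constants
of `F`, and `det(λI − A) = pₙ(λ) − x₁p_{n−1}(λ) − ⋯ − xₙp₀(λ)` for some basis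
`{pₙ,…,p₀}` of the space `F_n[λ]` of polynomials of degree at most `n`. -/
def IsPBCompanion {F : Type*} [Field F] {n : ℕ}
    (A : Matrix (Fin n) (Fin n) (MvPolynomial (Fin n) F)) : Prop :=
  (∃ pos : Fin n → Fin n × Fin n, Function.Injective pos ∧
    (∀ k : Fin n, A (pos k).1 (pos k).2 = MvPolynomial.X k) ∧
    (∀ i j : Fin n, (∀ k, pos k ≠ (i, j)) → ∃ c : F, A i j = MvPolynomial.C c)) ∧
  ∃ p : Fin (n + 1) → Polynomial F,
    (∀ i, p i ∈ Polynomial.degreeLT F (n + 1)) ∧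
    LinearIndependent F p ∧
    Submodule.span F (Set.range p) = Polynomial.degreeLT F (n + 1) ∧
    A.charpoly = (p ⟨n, n.lt_succ_self⟩).map (MvPolynomial.C : F →+* MvPolynomial (Fin n) F) -
      ∑ k : Fin n, Polynomial.C (MvPolynomial.X k) *
        (p ⟨n - 1 - (k : ℕ), by omega⟩).map (MvPolynomial.C : F →+* MvPolynomial (Fin n) F)

/-- The constant part of `A`: set `x₁ = ⋯ = xₙ = 0` in every entry. -/
def constPart {F : Type*} [Field F] {n : ℕ}
    (A : Matrix (Fin n) (Fin n) (MvPolynomial (Fin n) F)) : Matrix (Fin n) (Fin n) F :=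
  A.map (fun q => MvPolynomial.eval (fun _ => (0 : F)) q)

/-- The leading principal submatrix `A[1,…,m]` of order `m`. -/
def leadSub {R : Type*} {n : ℕ} (A : Matrix (Fin n) (Fin n) R) (m : ℕ) (h : m ≤ n) :
    Matrix (Fin m) (Fin m) R :=
  A.submatrix (Fin.castLE h) (Fin.castLE h)

/-- The trailing principal submatrix `A[n−m+1,…,n]` of order `m`. -/
def trailSub {R : Type*} {n : ℕ} (A : Matrix (Fin n) (Fin n) R) (m : ℕ) (h : m ≤ n) :
    Matrix (Fin m) (Fin m) R :=
  A.submatrix (fun i => ⟨n - m + (i : ℕ), by omega⟩) (fun i => ⟨n - m + (i : ℕ), by omega⟩)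

/-- A matrix whose entries are all constants of `F`. -/
def IsConstMatrix {F : Type*} [Field F] {n m : ℕ}
    (M : Matrix (Fin m) (Fin m) (MvPolynomial (Fin n) F)) : Prop :=
  ∀ i j, ∃ c : F, M i j = MvPolynomial.C c

/-- Membership in `𝔑^m_L(n₁,…,n_s)`: a constant ULH matrix of order `m` whose
leading principal submatrix of order `ns h` is nilpotent whenever `ns h ≠ 0`. -/
def MemNL {F : Type*} [Field F] {m : ℕ} (M : Matrix (Fin m) (Fin m) F)
    {s : ℕ} (ns : Fin s → ℕ) (hns : ∀ h, ns h ≤ m) : Prop :=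
  IsULH M ∧ ∀ h : Fin s, ns h ≠ 0 → IsNilpotent (leadSub M (ns h) (hns h))

/-- Membership in `𝔑^m_T(n₁,…,n_s)`: a constant ULH matrix of order `m` whose
trailing principal submatrix of order `ns h` is nilpotent whenever `ns h ≠ 0`. -/
def MemNT {F : Type*} [Field F] {m : ℕ} (M : Matrix (Fin m) (Fin m) F)
    {s : ℕ} (ns : Fin s → ℕ) (hns : ∀ h, ns h ≤ m) : Prop :=
  IsULH M ∧ ∀ h : Fin s, ns h ≠ 0 → IsNilpotent (trailSub M (ns h) (hns h))

/-- `s_k(A)`: the sum of the entries of the `k`-subdiagonal of `A`. -/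
def subdiagSum {F : Type*} [Field F] {n : ℕ}
    (A : Matrix (Fin n) (Fin n) (MvPolynomial (Fin n) F)) (k : ℕ) : MvPolynomial (Fin n) F :=
  ∑ i : Fin n, ∑ j : Fin n, if (i : ℕ) = (j : ℕ) + k then A i j else 0

/-- The upper shift matrix `Uₘ`: ones on the superdiagonal, zeros elsewhere. -/
def Ushift (R : Type*) [Zero R] [One R] (m : ℕ) : Matrix (Fin m) (Fin m) R :=
  fun i j => if (j : ℕ) = (i : ℕ) + 1 then 1 else 0

/-- The backward identity matrix `Jₘ`: ones on the antidiagonal, zeros elsewhere. -/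
def Jmat (R : Type*) [Zero R] [One R] (m : ℕ) : Matrix (Fin m) (Fin m) R :=
  fun i j => if (i : ℕ) + (j : ℕ) = m - 1 then 1 else 0

/-- The principal submatrix `M[b,…,e]` on rows and columns `b,…,e` (0-indexed). -/
def rangeSub {R : Type*} {m : ℕ} (M : Matrix (Fin m) (Fin m) R) (b e : ℕ) (h : e < m) :
    Matrix (Fin (e + 1 - b)) (Fin (e + 1 - b)) R :=
  M.submatrix (fun i => ⟨b + (i : ℕ), by omega⟩) (fun i => ⟨b + (i : ℕ), by omega⟩)

section Hessenberg

variable {R : Type*} [CommRing R]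

theorem det_eq_mul_of_lower_block (f : ℕ → ℕ → R) (p q : ℕ)
    (h : ∀ a b, a < p → p ≤ b → f a b = 0) :
    (Matrix.of fun a b : Fin (p + q) => f a b).det =
      (Matrix.of fun a b : Fin p => f a b).det *
        (Matrix.of fun a b : Fin q => f (p + a) (p + b)).det := by
  rw [← Matrix.det_submatrix_equiv_self finSumFinEquiv, ← Matrix.det_fromBlocks_zero₁₂ _
    (Matrix.of fun (a : Fin q) (b : Fin p) => f (p + a) b)]
  congr 1
  ext (a | a) (b | b)
  · simp
  · simpa using h a (p + b) a.isLt (by omega)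
  · simp
  · simp

/-- The minor of a lower Hessenberg matrix with superdiagonal `-1` obtained by deleting row `j + m`
and column `j`. -/
theorem det_hessenberg_minor (f : ℕ → ℕ → R) (j m t : ℕ) (h0 : ∀ a b, a + 1 < b → f a b = 0)
    (h1 : ∀ a, a < j + m → f a (a + 1) = -1) :
    (Matrix.of fun a b : Fin (j + (m + t)) =>
        f (if (a : ℕ) < j + m then a else a + 1) (if (b : ℕ) < j then b else b + 1)).det =
      (Matrix.of fun a b : Fin j => f a b).det * ((-1) ^ m *
        (Matrix.of fun a b : Fin t => f (j + m + 1 + a) (j + m + 1 + b)).det) := by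
  rw [det_eq_mul_of_lower_block
    (fun a b => f (if a < j + m then a else a + 1) (if b < j then b else b + 1))]
  swap
  · intro a b ha hb
    rw [if_pos (by omega), if_neg (by omega)]
    exact h0 _ _ (by omega)
  rw [det_eq_mul_of_lower_block
    (fun a b => f (if j + a < j + m then j + a else j + a + 1)
      (if j + b < j then j + b else j + b + 1))]
  swap
  · intro a b ha hb
    rw [if_pos (by omega), if_neg (by omega)]
    exact h0 _ _ (by omega)
  congr 1
  · congr 1
    ext a b
    have := a.isLt
    have := b.isLt
    simp only [Matrix.of_apply]
    rw [if_pos (by omega), if_pos (by omega)]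
  · congr 1
    · rw [Matrix.det_of_isLowerTriangular]
      · trans ∏ _a : Fin m, (-1 : R)
        · refine Finset.prod_congr rfl fun a _ => ?_
          have := a.isLt
          simp only [Matrix.of_apply]
          rw [if_pos (by omega), if_neg (by omega)]
          exact h1 _ (by omega)
        · simp
      · intro a b hab
        have hab' : (a : ℕ) < b := hab
        have := b.isLt
        simp only [Matrix.of_apply]
        rw [if_pos (by omega), if_neg (by omega)]
        exact h0 _ _ (by omega)
    · congr 1
      ext a b
      simp only [Matrix.of_apply]
      rw [if_neg (by omega), if_neg (by omega)]
      congr 1 <;> omega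

theorem IsULH.adjugate_charmatrix {n : ℕ} {A : Matrix (Fin n) (Fin n) R} (hA : IsULH A)
    {i j : Fin n} (hij : (j : ℕ) ≤ i) :
    A.charmatrix.adjugate j i =
      (leadSub A j j.isLt.le).charpoly * (trailSub A (n - 1 - i) (by omega)).charpoly := by
  obtain ⟨N, rfl⟩ : ∃ N, n = N + 1 := ⟨n - 1, by omega⟩
  rw [Matrix.adjugate_fin_succ_eq_det_submatrix]
  obtain ⟨i, hi⟩ := i
  obtain ⟨j, hj⟩ := j
  simp only at hij
  obtain ⟨m, rfl⟩ := Nat.exists_eq_add_of_le hij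
  obtain ⟨t, rfl⟩ : ∃ t, N = j + (m + t) := ⟨N - (j + m), by omega⟩
  set f : ℕ → ℕ → R[X] := fun a b =>
    if h : a < j + (m + t) + 1 ∧ b < j + (m + t) + 1 then A.charmatrix ⟨a, h.1⟩ ⟨b, h.2⟩ else 0
    with hf
  have hfv : ∀ a b : Fin (j + (m + t) + 1), A.charmatrix a b = f a b := by
    intro a b
    simp only [hf]
    rw [dif_pos ⟨a.isLt, b.isLt⟩]
  have h0 : ∀ a b, a + 1 < b → f a b = 0 := by
    intro a b hab
    simp only [hf]
    split_ifs with h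
    · rw [Matrix.charmatrix_apply_ne _ _ _ (by simp; omega), hA.2 _ _ hab]
      simp
    · rfl
  have h1 : ∀ a, a < j + m → f a (a + 1) = -1 := by
    intro a ha
    simp only [hf]
    rw [dif_pos (by omega), Matrix.charmatrix_apply_ne _ _ _ (by simp), hA.1 _ _ rfl]
    simp
  have key := det_hessenberg_minor f j m t h0 h1
  have e1 : A.charmatrix.submatrix (Fin.succAbove ⟨j + m, hi⟩) (Fin.succAbove ⟨j, hj⟩) =
      Matrix.of fun a b : Fin (j + (m + t)) =>
        f (if (a : ℕ) < j + m then a else a + 1) (if (b : ℕ) < j then b else b + 1) := by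
    ext1 a b
    rw [Matrix.submatrix_apply, hfv, Matrix.of_apply]
    congr 1
    · simp only [Fin.succAbove, Fin.lt_def, Fin.val_castSucc]
      split_ifs <;> rfl
    · simp only [Fin.succAbove, Fin.lt_def, Fin.val_castSucc]
      split_ifs <;> rfl
  have e2 : (leadSub A j hj.le).charpoly = (Matrix.of fun a b : Fin j => f a b).det := by
    rw [Matrix.charpoly]
    congr 1
    ext1 a b
    rw [Matrix.of_apply]
    refine Eq.trans ?_ (hfv (Fin.castLE hj.le a) (Fin.castLE hj.le b))
    simp [Matrix.charmatrix_apply, leadSub, Matrix.diagonal_apply, Fin.ext_iff]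
  have e3 : (trailSub A (j + (m + t) + 1 - 1 - (j + m)) (by omega)).charpoly =
      (Matrix.of fun a b : Fin t => f (j + m + 1 + a) (j + m + 1 + b)).det := by
    have ht : j + (m + t) + 1 - 1 - (j + m) = t := by omega
    rw [Matrix.charpoly, ← Matrix.det_submatrix_equiv_self (finCongr ht.symm)]
    congr 1
    ext1 a b
    have := a.isLt
    have := b.isLt
    rw [Matrix.of_apply]
    refine Eq.trans ?_ (hfv ⟨j + m + 1 + a, by omega⟩ ⟨j + m + 1 + b, by omega⟩)
    simp [Matrix.charmatrix_apply, trailSub, Matrix.diagonal_apply, Fin.ext_iff]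
    simp only [add_comm 1 (j + m)]
  rw [e1, key, e2, e3]
  have hs : ((-1 : R[X]) ^ (j + m + j)) * (-1) ^ m = 1 := by
    rw [← pow_add, Even.neg_one_pow ⟨j + m, by ring⟩]
  linear_combination ((Matrix.of fun a b : Fin j => f a b).det *
    (Matrix.of fun a b : Fin t => f (j + m + 1 + a) (j + m + 1 + b)).det) * hs

theorem charpoly_add_single {ι : Type*} [Fintype ι] [DecidableEq ι] (A : Matrix ι ι R) (i j : ι)
    (x : R) :
    (A + Matrix.single i j x).charpoly =
      A.charpoly - Polynomial.C x * A.charmatrix.adjugate j i := by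
  have h : (A + Matrix.single i j x).charmatrix = A.charmatrix.updateRow i
      (A.charmatrix i + (-Polynomial.C x) • Pi.single j 1) := by
    ext1 a b
    by_cases ha : a = i
    · subst ha
      by_cases hb : b = j
      · subst hb
        simp [Matrix.charmatrix_apply]
        ring
      · simp [Matrix.charmatrix_apply, hb, Ne.symm hb]
    · simp [Matrix.charmatrix_apply, ha, Ne.symm ha]
  rw [Matrix.charpoly, h, Matrix.det_updateRow_add, Matrix.det_updateRow_smul,
    Matrix.updateRow_eq_self, ← Matrix.adjugate_apply, Matrix.charpoly]
  ring

/-- Variables placed in a common block of a ULH matrix enter its characteristic polynomial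
linearly. -/
theorem IsULH.charpoly_add_sum_single {n : ℕ} {ι : Type*} {B : Matrix (Fin n) (Fin n) R}
    (hB : IsULH B) (i j : ι → Fin n) (x : ι → R) (h : ∀ k l, (j k : ℕ) ≤ i l) (S : Finset ι) :
    (B + ∑ k ∈ S, Matrix.single (i k) (j k) (x k)).charpoly =
      B.charpoly - ∑ k ∈ S, Polynomial.C (x k) *
        ((leadSub B (j k) (j k).isLt.le).charpoly *
          (trailSub B (n - 1 - (i k)) (by omega)).charpoly) := by
  classical
  induction S using Finset.induction_on with
  | empty => simp
  | insert k S hk ih =>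
    have hentry : ∀ a b : Fin n, (∀ l ∈ S, ¬ (i l = a ∧ j l = b)) →
        (B + ∑ l ∈ S, Matrix.single (i l) (j l) (x l)) a b = B a b := by
      intro a b hab
      rw [Matrix.add_apply, Matrix.sum_apply, Finset.sum_eq_zero, add_zero]
      intro l hl
      rw [Matrix.single_apply, if_neg (hab l hl)]
    have hU : IsULH (B + ∑ l ∈ S, Matrix.single (i l) (j l) (x l)) := by
      constructor
      · intro a b hab
        rw [hentry, hB.1 a b hab]
        rintro l - ⟨rfl, rfl⟩
        have := h l l
        omega
      · intro a b hab
        rw [hentry, hB.2 a b hab]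
        rintro l - ⟨rfl, rfl⟩
        have := h l l
        omega
    rw [Finset.sum_insert hk, Finset.sum_insert hk, add_comm (Matrix.single _ _ _), ← add_assoc,
      charpoly_add_single, ih, hU.adjugate_charmatrix (h k k)]
    have hl : leadSub (B + ∑ l ∈ S, Matrix.single (i l) (j l) (x l)) (j k) (j k).isLt.le =
        leadSub B (j k) (j k).isLt.le := by
      ext a b
      refine hentry _ _ ?_
      rintro l - ⟨h1, -⟩
      have h2 := h k l
      have h3 := congrArg Fin.val h1
      simp only [Fin.val_castLE] at h3
      omega
    have ht : trailSub (B + ∑ l ∈ S, Matrix.single (i l) (j l) (x l)) (n - 1 - (i k)) (by omega) =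
        trailSub B (n - 1 - (i k)) (by omega) := by
      ext a b
      refine hentry _ _ ?_
      rintro l - ⟨-, h1⟩
      have h2 := h l k
      have h3 := congrArg Fin.val h1
      simp only at h3
      omega
    rw [hl, ht]
    ring

theorem isNilpotent_iff_charpoly_eq_X_pow [IsDomain R] {m : ℕ} (M : Matrix (Fin m) (Fin m) R) :
    IsNilpotent M ↔ M.charpoly = Polynomial.X ^ m := by
  constructor
  · intro h
    have := Matrix.isNilpotent_charpoly_sub_pow_of_isNilpotent h
    simpa [sub_eq_zero] using this
  · intro h
    refine ⟨m, ?_⟩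
    simpa [h] using M.aeval_self_charpoly

theorem charpoly_mul_charpoly_eq_X_pow_iff [IsDomain R] {a b : ℕ} (M : Matrix (Fin a) (Fin a) R)
    (N : Matrix (Fin b) (Fin b) R) :
    M.charpoly * N.charpoly = Polynomial.X ^ (a + b) ↔ IsNilpotent M ∧ IsNilpotent N := by
  rw [isNilpotent_iff_charpoly_eq_X_pow, isNilpotent_iff_charpoly_eq_X_pow]
  refine ⟨fun h => ?_, fun h => by rw [h.1, h.2, pow_add]⟩
  have key : ∀ {c : ℕ} (L : Matrix (Fin c) (Fin c) R),
      L.charpoly ∣ Polynomial.X ^ (a + b) → L.charpoly = Polynomial.X ^ c := by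
    intro c L hL
    obtain ⟨e, -, he⟩ := (dvd_prime_pow Polynomial.prime_X _).1 hL
    have h1 := Polynomial.eq_of_monic_of_associated L.charpoly_monic (Polynomial.monic_X_pow e) he
    have h2 := L.charpoly_natDegree_eq_dim
    rw [h1, Polynomial.natDegree_X_pow, Fintype.card_fin] at h2
    rw [h1, h2]
  exact ⟨key M (h ▸ dvd_mul_right _ _), key N (h ▸ dvd_mul_left _ _)⟩

end Hessenberg

section Coefficients

variable {F : Type*} [Field F] {n : ℕ}

theorem map_C_sub_sum_eq_iff (p p' : F[X]) (q q' : Fin n → F[X]) :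
    p.map (MvPolynomial.C : F →+* MvPolynomial (Fin n) F) -
        ∑ k, Polynomial.C (MvPolynomial.X k) * (q k).map MvPolynomial.C =
      p'.map (MvPolynomial.C : F →+* MvPolynomial (Fin n) F) -
        ∑ k, Polynomial.C (MvPolynomial.X k) * (q' k).map MvPolynomial.C ↔
      p = p' ∧ ∀ k, q k = q' k := by
  constructor
  · intro h
    have key : ∀ v : Fin n → F, p - ∑ k, Polynomial.C (v k) * q k =
        p' - ∑ k, Polynomial.C (v k) * q' k := by
      intro v
      have hC : (MvPolynomial.eval v).comp MvPolynomial.C = RingHom.id F := by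
        ext
        simp
      simpa [Polynomial.map_sum, Polynomial.map_map, hC] using
        congrArg (Polynomial.map (MvPolynomial.eval v)) h
    have h0 : p = p' := by simpa using key 0
    refine ⟨h0, fun k => ?_⟩
    have hk := key (Pi.single k 1)
    simpa [h0, Pi.single_apply, apply_ite Polynomial.C, ite_mul] using hk
  · rintro ⟨rfl, h⟩
    simp [h]

end Coefficients

section Superpattern

variable {F : Type*} [Field F] {n : ℕ}

theorem CPos_injective {hn : 0 < n} {r : Fin n → Fin n} (hr : IsCIdx hn r) :
    Function.Injective (CPos r) := by
  intro k l h
  simp only [CPos, Prod.mk.injEq, Fin.mk.injEq] at h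
  have h1 := (hr k).1
  have h2 := (hr l).1
  have h3 := congrArg Fin.val h.1
  omega

theorem CMat_apply_CPos {hn : 0 < n} {r : Fin n → Fin n} (hr : IsCIdx hn r) (k : Fin n) :
    CMat F r (CPos r k).1 (CPos r k).2 = MvPolynomial.X k := by
  have h1 := (hr k).1
  rw [CMat, HMat, if_neg (by simp only [CPos]; omega), zero_add, Finset.sum_eq_single k]
  · simp
  · intro l _ hl
    exact if_neg fun h => hl (CPos_injective hr h)
  · simp

theorem CMat_apply_of_forall_ne {r : Fin n → Fin n} {i j : Fin n} (h : ∀ k, CPos r k ≠ (i, j)) :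
    CMat F r i j = if (j : ℕ) = i + 1 then 1 else 0 := by
  rw [CMat, HMat, Finset.sum_eq_zero fun k _ => if_neg (h k), add_zero]

variable {hn : 0 < n} {r : Fin n → Fin n}
  {A : Matrix (Fin n) (Fin n) (MvPolynomial (Fin n) F)}

theorem IsULHSuperpatternOf.apply_CPos (hr : IsCIdx hn r) (hA : IsULHSuperpatternOf A (CMat F r))
    (k : Fin n) : A (CPos r k).1 (CPos r k).2 = MvPolynomial.X k := by
  rcases hA.2 (CPos r k).1 (CPos r k).2 (Nat.sub_le _ _) with h | ⟨h, -⟩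
  · rw [h, CMat_apply_CPos hr]
  · rw [CMat_apply_CPos hr] at h
    exact absurd h (MvPolynomial.X_ne_zero k)

theorem IsULHSuperpatternOf.exists_eq_C (hA : IsULHSuperpatternOf A (CMat F r)) {i j : Fin n}
    (h : ∀ k, CPos r k ≠ (i, j)) : ∃ c : F, A i j = MvPolynomial.C c := by
  have hc : ∃ c : F, CMat F r i j = MvPolynomial.C c := by
    rw [CMat_apply_of_forall_ne h]
    split_ifs
    · exact ⟨1, by simp⟩
    · exact ⟨0, by simp⟩
  rcases lt_or_ge (i : ℕ) j with hij | hij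
  · rwa [hA.1 i j hij]
  · rcases hA.2 i j hij with h' | ⟨-, c, -, h'⟩
    · rwa [h']
    · exact ⟨c, h'⟩

theorem IsULHSuperpatternOf.eq_add_sum (hr : IsCIdx hn r)
    (hA : IsULHSuperpatternOf A (CMat F r)) :
    A = (constPart A).map MvPolynomial.C +
      ∑ k, Matrix.single (CPos r k).1 (CPos r k).2 (MvPolynomial.X k) := by
  ext1 i j
  rw [Matrix.add_apply, Matrix.sum_apply, Matrix.map_apply, constPart, Matrix.map_apply]
  by_cases h : ∃ k, CPos r k = (i, j)
  · obtain ⟨k, hk⟩ := h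
    have hX := hA.apply_CPos hr k
    rw [hk] at hX
    rw [hX, Finset.sum_eq_single k]
    · simp [hk]
    · intro l _ hl
      rw [Matrix.single_apply, if_neg]
      rintro ⟨h1, h2⟩
      exact hl (CPos_injective hr ((Prod.ext h1 h2).trans hk.symm))
    · simp
  · push Not at h
    obtain ⟨c, hc⟩ := hA.exists_eq_C h
    rw [hc, Finset.sum_eq_zero]
    · simp
    · intro l _
      rw [Matrix.single_apply, if_neg]
      rintro ⟨h1, h2⟩
      exact h l (Prod.ext h1 h2)

theorem IsULHSuperpatternOf.isULH_constPart (hA : IsULHSuperpatternOf A (CMat F r)) :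
    IsULH (constPart A) := by
  have hne : ∀ i j : Fin n, (i : ℕ) < j → ∀ k, CPos r k ≠ (i, j) := by
    rintro i j hij k h
    have h1 := congrArg (fun z => (z.1 : ℕ)) h
    have h2 := congrArg (fun z => (z.2 : ℕ)) h
    simp only [CPos] at h1 h2
    omega
  constructor
  · intro i j hij
    rw [constPart, Matrix.map_apply, hA.1 i j (by omega),
      CMat_apply_of_forall_ne (hne i j (by omega)), if_pos hij, map_one]
  · intro i j hij
    rw [constPart, Matrix.map_apply, hA.1 i j (by omega),
      CMat_apply_of_forall_ne (hne i j (by omega)), if_neg (by omega), map_zero]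

theorem IsULHSuperpatternOf.apply_eq_C_constPart (hA : IsULHSuperpatternOf A (CMat F r))
    {i j : Fin n} (h : ∀ k, CPos r k ≠ (i, j)) : A i j = MvPolynomial.C (constPart A i j) := by
  obtain ⟨c, hc⟩ := hA.exists_eq_C h
  rw [constPart, Matrix.map_apply, hc, MvPolynomial.eval_C]

theorem IsULHSuperpatternOf.leadSub_eq (hr : IsCIdx hn r) (hA : IsULHSuperpatternOf A (CMat F r))
    (k : Fin n) (hk : (r k : ℕ) - k ≤ n) :
    leadSub A ((r k : ℕ) - k) hk =
      (leadSub (constPart A) ((r k : ℕ) - k) hk).map MvPolynomial.C := by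
  ext1 a b
  refine hA.apply_eq_C_constPart fun l h => ?_
  have h1 := congrArg (fun z => (z.1 : ℕ)) h
  have h2 := (hr k).2.1
  have h3 := (hr l).2.2
  simp only [CPos, Fin.val_castLE] at h1
  omega

theorem IsULHSuperpatternOf.trailSub_eq (hr : IsCIdx hn r) (hA : IsULHSuperpatternOf A (CMat F r))
    (k : Fin n) (hk : n - 1 - (r k : ℕ) ≤ n) :
    trailSub A (n - 1 - (r k : ℕ)) hk =
      (trailSub (constPart A) (n - 1 - (r k : ℕ)) hk).map MvPolynomial.C := by
  ext1 a b
  refine hA.apply_eq_C_constPart fun l h => ?_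
  have h1 := congrArg (fun z => (z.2 : ℕ)) h
  have h2 := (hr l).2.1
  have h3 := (hr k).2.2
  simp only [CPos] at h1
  omega

theorem isNilpotent_map_C_iff {m : ℕ} (M : Matrix (Fin m) (Fin m) F) :
    IsNilpotent (M.map (MvPolynomial.C : F → MvPolynomial (Fin n) F)) ↔ IsNilpotent M :=
  IsNilpotent.map_iff (f := (MvPolynomial.C : F →+* MvPolynomial (Fin n) F).mapMatrix)
    (Matrix.map_injective (MvPolynomial.C_injective (Fin n) F))

theorem IsULHSuperpatternOf.charpoly_eq (hr : IsCIdx hn r)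
    (hA : IsULHSuperpatternOf A (CMat F r)) (hl : ∀ k, (r k : ℕ) - k ≤ n)
    (ht : ∀ k, n - 1 - (r k : ℕ) ≤ n) :
    A.charpoly = (constPart A).charpoly.map (MvPolynomial.C : F →+* MvPolynomial (Fin n) F) -
      ∑ k, Polynomial.C (MvPolynomial.X k) *
        ((leadSub (constPart A) ((r k : ℕ) - k) (hl k)).charpoly *
          (trailSub (constPart A) (n - 1 - (r k : ℕ)) (ht k)).charpoly).map
            (MvPolynomial.C : F →+* MvPolynomial (Fin n) F) := by
  have hU : IsULH ((constPart A).map (MvPolynomial.C : F →+* MvPolynomial (Fin n) F)) := by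
    refine ⟨fun i j h => ?_, fun i j h => ?_⟩
    · rw [Matrix.map_apply, hA.isULH_constPart.1 i j h, map_one]
    · rw [Matrix.map_apply, hA.isULH_constPart.2 i j h, map_zero]
  have hpos : ∀ k l, ((CPos r k).2 : ℕ) ≤ (CPos r l).1 := fun k l =>
    (hr k).2.1.trans (hr l).2.2
  have key := hU.charpoly_add_sum_single (fun k => (CPos r k).1) (fun k => (CPos r k).2)
    MvPolynomial.X hpos Finset.univ
  rw [← hA.eq_add_sum hr, Matrix.charpoly_map] at key
  rw [key]
  refine congrArg _ (Finset.sum_congr rfl fun k _ => congrArg _ ?_)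
  rw [Polynomial.map_mul, ← Matrix.charpoly_map, ← Matrix.charpoly_map]
  rfl

end Superpattern

/-- A ULH superpattern `A` of `C_{i₁,…,iₙ} ∈ 𝒞` is a companion
matrix iff (i) the constant part of `A` is nilpotent, (ii) each `A[1,…,iₖ−k]` is a
constant nilpotent matrix or empty, and (iii) each `A[iₖ+1,…,n]` is a constant
nilpotent matrix or empty. -/
theorem superpattern_isCompanion_iff {F : Type*} [Field F] {n : ℕ} (hn : 0 < n)
    (r : Fin n → Fin n) (hr : IsCIdx hn r)
    (A : Matrix (Fin n) (Fin n) (MvPolynomial (Fin n) F))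
    (hA : IsULHSuperpatternOf A (CMat F r)) :
    IsCompanion A ↔
      (IsNilpotent (constPart A) ∧
      (∀ k : Fin n,
        IsConstMatrix (leadSub A ((r k : ℕ) - (k : ℕ)) (le_trans (Nat.sub_le _ _) (r k).isLt.le)) ∧
        IsNilpotent (leadSub A ((r k : ℕ) - (k : ℕ)) (le_trans (Nat.sub_le _ _) (r k).isLt.le))) ∧
      (∀ k : Fin n,
        IsConstMatrix (trailSub A (n - 1 - (r k : ℕ)) (by omega)) ∧
        IsNilpotent (trailSub A (n - 1 - (r k : ℕ)) (by omega)))) := by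
  have hcomp : IsCompanion A ↔ A.charpoly = Polynomial.X ^ n -
      ∑ k : Fin n, Polynomial.C (MvPolynomial.X k) * Polynomial.X ^ (n - 1 - (k : ℕ)) :=
    and_iff_right ⟨CPos r, CPos_injective hr, hA.apply_CPos hr, fun _ _ => hA.exists_eq_C⟩
  have hcoeff := map_C_sub_sum_eq_iff (constPart A).charpoly (Polynomial.X ^ n)
    (fun k => (leadSub (constPart A) ((r k : ℕ) - k)
        (le_trans (Nat.sub_le _ _) (r k).isLt.le)).charpoly *
      (trailSub (constPart A) (n - 1 - (r k : ℕ)) (by omega)).charpoly)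
    (fun k => Polynomial.X ^ (n - 1 - (k : ℕ)))
  simp only [Polynomial.map_pow, Polynomial.map_X] at hcoeff
  have hfactor : ∀ k : Fin n,
      (leadSub (constPart A) ((r k : ℕ) - k)
          (le_trans (Nat.sub_le _ _) (r k).isLt.le)).charpoly *
        (trailSub (constPart A) (n - 1 - (r k : ℕ)) (by omega)).charpoly =
          Polynomial.X ^ (n - 1 - (k : ℕ)) ↔
      IsNilpotent (leadSub A ((r k : ℕ) - k) (le_trans (Nat.sub_le _ _) (r k).isLt.le)) ∧
        IsNilpotent (trailSub A (n - 1 - (r k : ℕ)) (by omega)) := by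
    intro k
    rw [hA.leadSub_eq hr, hA.trailSub_eq hr, isNilpotent_map_C_iff, isNilpotent_map_C_iff,
      ← charpoly_mul_charpoly_eq_X_pow_iff]
    have hk := (hr k).1
    rw [show n - 1 - (k : ℕ) = (r k : ℕ) - k + (n - 1 - r k) by omega]
  have hlead : ∀ k : Fin n, IsConstMatrix
      (leadSub A ((r k : ℕ) - k) (le_trans (Nat.sub_le _ _) (r k).isLt.le)) := by
    intro k a b
    rw [hA.leadSub_eq hr]
    exact ⟨_, rfl⟩
  have htrail : ∀ k : Fin n, IsConstMatrix (trailSub A (n - 1 - (r k : ℕ)) (by omega)) := by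
    intro k a b
    rw [hA.trailSub_eq hr]
    exact ⟨_, rfl⟩
  rw [hcomp, hA.charpoly_eq hr (fun k => le_trans (Nat.sub_le _ _) (r k).isLt.le)
    (fun k => by omega), hcoeff, ← isNilpotent_iff_charpoly_eq_X_pow]
  simp only [hfactor, hlead, htrail, true_and, forall_and]
end
end

section
/- If A ∈ Ĉ (all nonzero entries of A are either superdiagonal ones or lie in the i_1-block determined by the position of x_1), then the characteristic polynomial of A is det(λI_n − A) = λ^n − s_0(A)λ^{n−1} − s_1(A)λ^{n−2} − ⋯ − s_{n−2}(A)λ − s_{n−1}(A), where s_k(A) is the sum of the entries on the k-subdiagonal of A. -/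
open Polynomial Matrix

noncomputable section

/-- A lower Hessenberg matrix with superdiagonal entries `-1` that maps a vector with first
coordinate `1` to `p` times the last basis vector has determinant `p`. -/
theorem det_eq_of_mulVec_eq_single_last {R : Type*} [CommRing R] {m : ℕ}
    (M : Matrix (Fin (m + 1)) (Fin (m + 1)) R)
    (hsuper : ∀ i j : Fin (m + 1), (j : ℕ) = (i : ℕ) + 1 → M i j = -1)
    (habove : ∀ i j : Fin (m + 1), (i : ℕ) + 1 < (j : ℕ) → M i j = 0)
    (x : Fin (m + 1) → R) (hx : x 0 = 1) (p : R)
    (hM : M *ᵥ x = Pi.single (Fin.last m) p) : M.det = p := by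
  have h : M.adjugate *ᵥ (M *ᵥ x) = M.det • x := by
    rw [Matrix.mulVec_mulVec, Matrix.adjugate_mul, Matrix.smul_mulVec, Matrix.one_mulVec]
  have h0 := congrFun h 0
  have hminor : (M.submatrix (Fin.last m).succAbove (Fin.succAbove 0)).det = (-1) ^ m := by
    rw [Matrix.det_of_isLowerTriangular]
    · rw [Finset.prod_congr rfl (g := fun _ => (-1 : R))]
      · simp
      · intro i _
        exact hsuper _ _ (by simp)
    · intro i j hij
      have hij' : (i : ℕ) < (j : ℕ) := hij
      exact habove _ _ (by simpa using hij')
  have hsign : ((-1 : R) ^ m) * (-1) ^ m = 1 := by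
    rw [← mul_pow]; simp
  rw [hM, Pi.smul_apply, hx, smul_eq_mul, mul_one, Matrix.mulVec_single,
    Pi.smul_apply, Matrix.col_apply, Matrix.adjugate_fin_succ_eq_det_submatrix, hminor] at h0
  simp only [Fin.val_last, Fin.val_zero, add_zero, hsign] at h0
  simpa using h0.symm

/-- The characteristic polynomial of a unit lower Hessenberg matrix whose entries on and below
the diagonal are supported in rows `≥ t` and columns `≤ t`. -/
theorem IsULH.charpoly_eq_of_block {R : Type*} [CommRing R] {m : ℕ}
    {A : Matrix (Fin (m + 1)) (Fin (m + 1)) R} (hA : IsULH A) (t : ℕ)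
    (hblock : ∀ i j : Fin (m + 1), (j : ℕ) ≤ (i : ℕ) → A i j ≠ 0 → t ≤ (i : ℕ) ∧ (j : ℕ) ≤ t) :
    A.charpoly = X ^ (m + 1) - ∑ i : Fin (m + 1), ∑ j : Fin (m + 1),
      if (j : ℕ) ≤ (i : ℕ) then C (A i j) * X ^ (m - ((i : ℕ) - (j : ℕ))) else 0 := by
  let b : Fin (m + 1) → R[X] := fun i =>
    ∑ j : Fin (m + 1), if (j : ℕ) ≤ (i : ℕ) then C (A i j) * X ^ (j : ℕ) else 0
  let y : ℕ → R[X] := fun k => Nat.rec 1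
    (fun k y => X * y - if h : k < m + 1 then b ⟨k, h⟩ else 0) k
  have y_succ : ∀ i : Fin (m + 1), y (i + 1) = X * y i - b i := by
    intro i
    change X * y i - (if h : (i : ℕ) < m + 1 then b ⟨i, h⟩ else 0) = _
    rw [dif_pos i.isLt]
  have b_zero : ∀ i : Fin (m + 1), (i : ℕ) < t → b i = 0 := by
    intro i hi
    refine Finset.sum_eq_zero fun j _ => ?_
    split_ifs with hij
    · have : A i j = 0 := by
        by_contra h
        exact absurd (hblock i j hij h).1 (by omega)
      simp [this]
    · rfl
  have y_pow : ∀ k : ℕ, k ≤ t → k ≤ m + 1 → y k = X ^ k := by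
    intro k
    induction k with
    | zero => intro _ _; rfl
    | succ k ih =>
      intro hk hk'
      rw [y_succ ⟨k, by omega⟩, b_zero _ (by exact hk)]
      simp only [sub_zero]
      rw [ih (by omega) (by omega), pow_succ']
  have y_eq : ∀ k : ℕ, k ≤ m + 1 → y k = X ^ k -
      ∑ i : Fin (m + 1), if (i : ℕ) < k then b i * X ^ (k - 1 - (i : ℕ)) else 0 := by
    intro k
    induction k with
    | zero => intro _; simp [y]
    | succ k ih =>
      intro hk
      have hsum : (∑ i : Fin (m + 1), if (i : ℕ) < k + 1 then b i * X ^ (k + 1 - 1 - (i : ℕ)) else 0)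
          = X * (∑ i : Fin (m + 1), if (i : ℕ) < k then b i * X ^ (k - 1 - (i : ℕ)) else 0)
            + b ⟨k, hk⟩ := by
        have hb : b ⟨k, hk⟩ = ∑ i, if i = (⟨k, hk⟩ : Fin (m + 1)) then b i else 0 := by simp
        rw [Finset.mul_sum, hb, ← Finset.sum_add_distrib]
        refine Finset.sum_congr rfl fun i _ => ?_
        rcases lt_trichotomy (i : ℕ) k with h | h | h
        · rw [if_pos (by omega), if_pos h, if_neg (by rw [Fin.ext_iff]; exact h.ne), add_zero,
            show k + 1 - 1 - (i : ℕ) = (k - 1 - (i : ℕ)) + 1 by omega]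
          ring
        · rw [if_pos (by omega), if_neg (by omega), if_pos (Fin.ext h),
            show k + 1 - 1 - (i : ℕ) = 0 by omega]
          ring
        · rw [if_neg (by omega), if_neg (by omega), if_neg (by rw [Fin.ext_iff]; exact h.ne')]
          ring
      rw [hsum, y_succ ⟨k, hk⟩]
      change X * y k - _ = _
      rw [ih (by omega)]
      ring
  have hdet : A.charpoly = y (m + 1) := by
    refine det_eq_of_mulVec_eq_single_last A.charmatrix ?_ ?_ (fun i => y i) rfl _ ?_
    · intro i j hij
      rw [Matrix.charmatrix_apply_ne _ _ _ (by rintro rfl; omega), hA.1 i j hij, C_1]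
    · intro i j hij
      rw [Matrix.charmatrix_apply_ne _ _ _ (by rintro rfl; omega), hA.2 i j hij, C_0, neg_zero]
    · funext i
      have hrow : (A.charmatrix *ᵥ fun j => y j) i
          = X * y i - ∑ j : Fin (m + 1), C (A i j) * y j := by
        simp [Matrix.mulVec, dotProduct, Matrix.charmatrix_apply, sub_mul, Finset.sum_sub_distrib,
          Matrix.diagonal_apply]
      have hsum : ∑ j : Fin (m + 1), C (A i j) * y j
          = b i + ∑ j : Fin (m + 1), if (j : ℕ) = (i : ℕ) + 1 then y j else 0 := by
        rw [← Finset.sum_add_distrib]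
        refine Finset.sum_congr rfl fun j _ => ?_
        rcases le_or_gt (j : ℕ) (i : ℕ) with h | h
        · rw [if_pos h, if_neg (by omega), add_zero]
          by_cases h0 : A i j = 0
          · simp [h0]
          · rw [y_pow j (hblock i j h h0).2 (by omega)]
        · rw [if_neg (by omega), zero_add]
          split_ifs with h1
          · rw [hA.1 i j h1, C_1, one_mul]
          · rw [hA.2 i j (by omega), C_0, zero_mul]
      rw [hrow, hsum, ← sub_sub, ← y_succ]
      rcases Fin.eq_castSucc_or_eq_last i with ⟨k, rfl⟩ | rfl
      · rw [Finset.sum_eq_single k.succ]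
        · simp [(Fin.castSucc_lt_last k).ne]
        · intro j _ hj
          rw [if_neg]
          intro h
          exact hj (Fin.ext (by simpa using h))
        · simp
      · rw [Finset.sum_eq_zero]
        · simp
        · intro j _
          rw [if_neg]
          have := j.isLt
          simp only [Fin.val_last]
          omega
  rw [hdet, y_eq _ le_rfl]
  congr 1
  refine Finset.sum_congr rfl fun i _ => ?_
  rw [if_pos i.isLt, Finset.sum_mul]
  refine Finset.sum_congr rfl fun j _ => ?_
  rw [ite_mul, zero_mul]
  refine if_ctx_congr Iff.rfl (fun h => ?_) fun _ => rfl
  rw [mul_assoc, ← pow_add]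
  congr 2
  omega

/-- Above the main diagonal, the matrix `C_{i₁,…,iₙ}` has ones on the superdiagonal and zeros
elsewhere. -/
theorem CMat_apply_of_lt {F : Type*} [Field F] {n : ℕ} (r : Fin n → Fin n) {i j : Fin n}
    (hij : (i : ℕ) < (j : ℕ)) :
    CMat F r i j = if (j : ℕ) = (i : ℕ) + 1 then 1 else 0 := by
  rw [CMat, HMat, Finset.sum_eq_zero, add_zero]
  intro k _
  rw [if_neg]
  intro h
  have h1 : r k = i := congrArg Prod.fst h
  have h2 : (r k : ℕ) - (k : ℕ) = (j : ℕ) := congrArg (fun q => (q.2 : ℕ)) h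
  rw [h1] at h2
  omega

/-- A ULH superpattern of a matrix of `𝒞` is unit lower Hessenberg. -/
theorem IsULHSuperpatternOf.isULH {F : Type*} [Field F] {n : ℕ} {r : Fin n → Fin n}
    {A : Matrix (Fin n) (Fin n) (MvPolynomial (Fin n) F)}
    (hA : IsULHSuperpatternOf A (CMat F r)) : IsULH A := by
  refine ⟨fun i j hij => ?_, fun i j hij => ?_⟩
  · rw [hA.1 i j (by omega), CMat_apply_of_lt r (by omega), if_pos hij]
  · rw [hA.1 i j (by omega), CMat_apply_of_lt r (by omega), if_neg (by omega)]

/-- Regrouping by subdiagonals the sum over the entries on and below the diagonal. -/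
theorem sum_subdiagSum_mul_X_pow {F : Type*} [Field F] {n : ℕ}
    (A : Matrix (Fin n) (Fin n) (MvPolynomial (Fin n) F)) :
    ∑ k : Fin n, C (subdiagSum A (k : ℕ)) * X ^ (n - 1 - (k : ℕ)) =
      ∑ i : Fin n, ∑ j : Fin n,
        if (j : ℕ) ≤ (i : ℕ) then C (A i j) * X ^ (n - 1 - ((i : ℕ) - (j : ℕ))) else 0 := by
  simp only [subdiagSum, map_sum, Finset.sum_mul]
  rw [Finset.sum_comm]
  refine Finset.sum_congr rfl fun i _ => ?_
  rw [Finset.sum_comm]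
  refine Finset.sum_congr rfl fun j _ => ?_
  split_ifs with hij
  · rw [Finset.sum_eq_single (⟨(i : ℕ) - (j : ℕ), by omega⟩ : Fin n)]
    · rw [if_pos (by simp only; omega)]
    · intro k _ hk
      rw [if_neg, C_0, zero_mul]
      intro h
      exact hk (Fin.ext (by simp only; omega))
    · simp
  · refine Finset.sum_eq_zero fun k _ => ?_
    rw [if_neg (by omega), C_0, zero_mul]

/-- If `A ∈ Ĉ` (a ULH superpattern of a matrix of `𝒞` all of whose
nonzero entries are superdiagonal ones or lie in the `i₁`-block), then
`det(λI − A) = λⁿ − s₀(A)λ^{n−1} − s₁(A)λ^{n−2} − ⋯ − s_{n−1}(A)`, where `sₖ(A)` is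
the sum of the entries on the `k`-subdiagonal of `A`. -/
theorem charpoly_of_mem_Chat {F : Type*} [Field F] {n : ℕ} (hn : 0 < n)
    (r : Fin n → Fin n) (hr : IsCIdx hn r)
    (A : Matrix (Fin n) (Fin n) (MvPolynomial (Fin n) F))
    (hA : IsULHSuperpatternOf A (CMat F r))
    (hblock : ∀ i j : Fin n, A i j ≠ 0 →
      ((j : ℕ) = (i : ℕ) + 1 ∨ ((r ⟨0, hn⟩ : ℕ) ≤ (i : ℕ) ∧ (j : ℕ) ≤ (r ⟨0, hn⟩ : ℕ)))) :
    A.charpoly = Polynomial.X ^ n -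
      ∑ k : Fin n, Polynomial.C (subdiagSum A (k : ℕ)) * Polynomial.X ^ (n - 1 - (k : ℕ)) := by
  obtain ⟨m, rfl⟩ : ∃ m, n = m + 1 := ⟨n - 1, by omega⟩
  rw [sum_subdiagSum_mul_X_pow]
  refine hA.isULH.charpoly_eq_of_block (r ⟨0, hn⟩) fun i j hij h => ?_
  rcases hblock i j h with h' | h'
  · omega
  · exact h'
end
end
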